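/- Let (m_i)_{i≥1} be a sequence of odd positive integers such that m_i → ∞ and (log₂ m_i)/ℓ_{m_i} → 0 as i → ∞. Let δ be a real number with 0 < δ < 1/3 and H(3δ/2) < 1/2. For each i, let P_i be the fraction of pairs (a(X), b(X)) ∈ J_{m_i} × J_{m_i} such that every nonzero codeword (f, 2g) of C_{a,b} satisfies wt_H(f) + 2·wt_H(g) > 3 m_i δ (i.e., the relative minimum distance Δ(C_{a,b}) = wt(C_{a,b})/(3m_i) exceeds δ). Then lim_{i→∞} P_i = 1. -/

import Mathlib

open Polynomial

noncomputable section

/-- The polynomial `X^m - 1` over `Z/2`. -/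
def fm (m : ℕ) : Polynomial (ZMod 2) := X ^ m - 1

/-- The polynomial `X^m - 1` over `Z/4`. -/
def fm4 (m : ℕ) : Polynomial (ZMod 4) := X ^ m - 1

/-- `R_m = (Z/2)[X]/⟨X^m - 1⟩`. -/
abbrev R2 (m : ℕ) : Type := Polynomial (ZMod 2) ⧸ Ideal.span {fm m}

/-- `R'_m = (Z/4)[X]/⟨X^m - 1⟩`. -/
abbrev R4 (m : ℕ) : Type := Polynomial (ZMod 4) ⧸ Ideal.span {fm4 m}

def mk2 (m : ℕ) : Polynomial (ZMod 2) →+* R2 m := Ideal.Quotient.mk _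

def mk4 (m : ℕ) : Polynomial (ZMod 4) →+* R4 m := Ideal.Quotient.mk _

/-- The canonical representative (of degree `< m`) of an element of `R2 m`. -/
def rep2 (m : ℕ) (r : R2 m) : Polynomial (ZMod 2) :=
  (Function.surjInv (Ideal.Quotient.mk_surjective (I := Ideal.span {fm m})) r) %ₘ fm m

/-- The canonical representative (of degree `< m`) of an element of `R4 m`. -/
def rep4 (m : ℕ) (r : R4 m) : Polynomial (ZMod 4) :=
  (Function.surjInv (Ideal.Quotient.mk_surjective (I := Ideal.span {fm4 m})) r) %ₘ fm4 m

/-- Coefficientwise doubling map `(Z/2)[X] → (Z/4)[X]`, `a ↦ 2a` on each coefficient. -/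
def polyDbl (p : Polynomial (ZMod 2)) : Polynomial (ZMod 4) :=
  ∑ i ∈ p.support, Polynomial.C (2 * ((p.coeff i).val : ZMod 4)) * X ^ i

/-- The additive embedding `R_m → R'_m`, `f ↦ 2f`. -/
def iota (m : ℕ) (r : R2 m) : R4 m := mk4 m (polyDbl (rep2 m r))

/-- Hamming weight of an element of `R_m` (of its coefficient vector). -/
def wt2 (m : ℕ) (r : R2 m) : ℕ := (rep2 m r).support.card

/-- Lee weight of an element of `Z/4`. -/
def lee (x : ZMod 4) : ℕ := min x.val (4 - x.val)

/-- Lee weight of an element of `R'_m` (of its coefficient vector). -/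
def wtLee (m : ℕ) (r : R4 m) : ℕ := ∑ i ∈ (rep4 m r).support, lee ((rep4 m r).coeff i)

/-- The augmentation ideal `J_m = ⟨X - 1⟩` of `R_m`. -/
def Jm (m : ℕ) : Ideal (R2 m) := Ideal.span {mk2 m (X - 1)}

/-- The `Z2Z4`-additive cyclic code `C_{a,b} = {(f·a, 2(f·b)) : f ∈ R_m}`. -/
def Cab (m : ℕ) (a b : R2 m) : Set (R2 m × R4 m) :=
  {w | ∃ f : R2 m, w = (f * a, iota m (f * b))}

/-- Dimension of `C_{a,b}` as a vector space over `Z/2`, i.e. `log₂ |C_{a,b}|`. -/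
def dimCab (m : ℕ) (a b : R2 m) : ℕ := Nat.log 2 (Nat.card (Cab m a b))

/-- `(X^m - 1)/(X - 1) = X^{m-1} + ⋯ + X + 1` over `Z/2`. -/
def geomPoly (m : ℕ) : Polynomial (ZMod 2) := ∑ i ∈ Finset.range m, X ^ i

/-- `ℓ_m`: minimal degree of the irreducible factors of `(X^m-1)/(X-1)` in `(Z/2)[X]`. -/
def ell (m : ℕ) : ℕ :=
  sInf {d | ∃ p : Polynomial (ZMod 2), Irreducible p ∧ p ∣ geomPoly m ∧ p.natDegree = d}

/-- The binary entropy function `H(x) = -x·log₂x - (1-x)·log₂(1-x)`. -/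
def Hent (x : ℝ) : ℝ := -(x * Real.logb 2 x) - (1 - x) * Real.logb 2 (1 - x)

lemma fm_monic (m : ℕ) (hm : m ≠ 0) : (fm m).Monic := by
  have := monic_X_pow_sub_C (1 : ZMod 2) hm
  simpa [fm] using this

lemma fm_natDegree (m : ℕ) : (fm m).natDegree = m := by
  have := natDegree_X_pow_sub_C (n := m) (r := (1 : ZMod 2))
  simpa [fm] using this

lemma fm_degree (m : ℕ) (hm : m ≠ 0) : (fm m).degree = m := by
  have := degree_X_pow_sub_C (Nat.pos_of_ne_zero hm) (1 : ZMod 2)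
  simpa [fm] using this

lemma mk2_eq_zero_iff (m : ℕ) (p : Polynomial (ZMod 2)) : mk2 m p = 0 ↔ fm m ∣ p := by
  unfold mk2
  rw [Ideal.Quotient.eq_zero_iff_mem, Ideal.mem_span_singleton]

lemma mk2_surj (m : ℕ) : Function.Surjective (mk2 m) := Ideal.Quotient.mk_surjective

lemma mk2_rep2 (m : ℕ) (r : R2 m) : mk2 m (rep2 m r) = r := by
  unfold rep2
  rw [modByMonic_eq_sub_mul_div, map_sub, map_mul, (mk2_eq_zero_iff m (fm m)).2 dvd_rfl, zero_mul,
    sub_zero]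
  exact Function.surjInv_eq _ r

lemma rep2_degree (m : ℕ) (hm : m ≠ 0) (r : R2 m) : (rep2 m r).degree < m := by
  have := degree_modByMonic_lt
    (Function.surjInv (Ideal.Quotient.mk_surjective (I := Ideal.span {fm m})) r) (fm_monic m hm)
  rwa [fm_degree m hm] at this

lemma rep2_mk2 (m : ℕ) (hm : m ≠ 0) (p : Polynomial (ZMod 2)) (hp : p.degree < m) :
    rep2 m (mk2 m p) = p := by
  have h1 : fm m ∣ rep2 m (mk2 m p) - p := by
    rw [← mk2_eq_zero_iff, map_sub, mk2_rep2, sub_self]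
  have h2 := eq_zero_of_dvd_of_degree_lt h1 (by
    rw [fm_degree m hm]
    exact lt_of_le_of_lt (degree_sub_le _ _) (max_lt (rep2_degree m hm _) hp))
  exact sub_eq_zero.1 h2

lemma iota_zero (m : ℕ) (hm : m ≠ 0) : iota m 0 = 0 := by
  have : rep2 m 0 = 0 := by
    have := rep2_mk2 m hm 0 (by simp)
    simpa using this
  simp [iota, this, polyDbl]

/-- coefficient function -/
def cf (m : ℕ) (u : R2 m) (i : ZMod m) : ZMod 2 := (rep2 m u).coeff i.val

lemma cf_ext (m : ℕ) [NeZero m] (u v : R2 m) (h : ∀ i, cf m u i = cf m v i) : u = v := by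
  rw [← mk2_rep2 m u, ← mk2_rep2 m v]
  congr 1
  ext n
  by_cases hn : n < m
  · have := h (n : ZMod m)
    simpa [cf, ZMod.val_natCast, Nat.mod_eq_of_lt hn] using this
  · push Not at hn
    have key : ∀ w : R2 m, (rep2 m w).coeff n = 0 := fun w =>
      coeff_eq_zero_of_degree_lt (lt_of_lt_of_le (rep2_degree m (NeZero.ne m) w) (by exact_mod_cast hn))
    rw [key, key]

instance R2_finite (m : ℕ) [NeZero m] : Finite (R2 m) :=
  Finite.of_injective (cf m) (fun u v h => cf_ext m u v (fun i => congrFun h i))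

instance R2_fintype (m : ℕ) [NeZero m] : Fintype (R2 m) := Fintype.ofFinite _

lemma cf_shift (m : ℕ) [NeZero m] (u : R2 m) (i : ZMod m) :
    cf m (mk2 m X * u) i = cf m u (i - 1) := by
  have hm : m ≠ 0 := NeZero.ne m
  set p := rep2 m u with hp
  have hpd : p.degree < m := rep2_degree m hm u
  have hq : ∀ n, (X * p - C (p.coeff (m-1)) * fm m).coeff n =
      (if n = 0 then p.coeff (m-1) else p.coeff (n-1) - if n = m then p.coeff (m-1) else 0) := by
    intro n
    rcases n with _ | n
    · simp [fm, coeff_X_pow, Ne.symm hm]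
    · simp [fm, coeff_X_pow, coeff_one]
  have hrep : rep2 m (mk2 m X * u) = X * p - C (p.coeff (m-1)) * fm m := by
    have h1 : mk2 m X * u = mk2 m (X * p - C (p.coeff (m-1)) * fm m) := by
      rw [map_sub, map_mul, map_mul, (mk2_eq_zero_iff m (fm m)).2 dvd_rfl, hp, mk2_rep2]; simp
    rw [h1]
    apply rep2_mk2 m hm
    rw [degree_lt_iff_coeff_zero]
    intro n hn
    rw [hq, if_neg (by omega)]
    by_cases h : n = m
    · simp [h]
    · rw [if_neg h, sub_zero]
      rw [degree_lt_iff_coeff_zero] at hpd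
      exact hpd _ (by omega)
  unfold cf
  rw [hrep, hq]
  have hi := ZMod.val_lt i
  by_cases h0 : i = 0
  · subst h0
    simp only [ZMod.val_zero, if_true, zero_sub]
    congr 1
    obtain ⟨k, rfl⟩ := Nat.exists_eq_succ_of_ne_zero hm
    rw [ZMod.val_neg_one]; rfl
  · have h0' : i.val ≠ 0 := by rwa [Ne, ZMod.val_eq_zero]
    rw [if_neg h0', if_neg (by omega), sub_zero]
    congr 1
    have h1 : (1 : ZMod m).val = 1 := by
      rw [ZMod.val_one'']; omega
    rw [ZMod.val_sub (by rw [h1]; omega), h1]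

lemma cf_shift_pow (m : ℕ) [NeZero m] (u : R2 m) (k : ℕ) (i : ZMod m) :
    cf m (mk2 m X ^ k * u) i = cf m u (i - k) := by
  induction k generalizing i with
  | zero => simp
  | succ k ih =>
    rw [pow_succ', mul_assoc, cf_shift, ih]
    congr 1; push_cast; ring

lemma wt2_eq (m : ℕ) [NeZero m] (u : R2 m) :
    wt2 m u = (Finset.univ.filter (fun i => cf m u i ≠ 0)).card := by
  unfold wt2
  symm
  apply Finset.card_bij (fun (i : ZMod m) _ => i.val)
  · intro i hi
    exact mem_support_iff.2 (Finset.mem_filter.1 hi).2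
  · intro a _ b _ h
    exact ZMod.val_injective m h
  · intro n hn
    have hlt : n < m := by
      by_contra hc
      push Not at hc
      exact (mem_support_iff.1 hn) (coeff_eq_zero_of_degree_lt
        (lt_of_lt_of_le (rep2_degree m (NeZero.ne m) u) (by exact_mod_cast hc)))
    refine ⟨(n : ZMod m), ?_, ?_⟩
    · refine Finset.mem_filter.2 ⟨Finset.mem_univ _, ?_⟩
      simpa [cf, ZMod.val_natCast, Nat.mod_eq_of_lt hlt] using hn
    · simp [ZMod.val_natCast, Nat.mod_eq_of_lt hlt]

/-- window -/
def win (m d : ℕ) [NeZero m] : Finset (ZMod m) := Finset.univ.filter (fun i => m - d ≤ i.val)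

lemma win_card (m d : ℕ) [NeZero m] (hd : d ≤ m) : (win m d).card = d := by
  have : (win m d).card = (Finset.Ico (m-d) m).card := by
    apply Finset.card_bij (fun (i : ZMod m) _ => i.val)
    · intro i hi
      simp only [win, Finset.mem_filter, Finset.mem_univ, true_and] at hi
      exact Finset.mem_Ico.2 ⟨hi, ZMod.val_lt i⟩
    · intro a _ b _ h
      exact ZMod.val_injective m h
    · intro n hn
      rw [Finset.mem_Ico] at hn
      refine ⟨(n : ZMod m), ?_, ?_⟩
      · simp [win, ZMod.val_natCast, Nat.mod_eq_of_lt hn.2]; omega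
      · simp [ZMod.val_natCast, Nat.mod_eq_of_lt hn.2]
  rw [this, Nat.card_Ico]; omega

def wsup (m d : ℕ) [NeZero m] (u : R2 m) : Finset (ZMod m) := (win m d).filter (fun i => cf m u i ≠ 0)

lemma sum_wsup (m d : ℕ) [NeZero m] (hd : d ≤ m) (u : R2 m) :
    ∑ k : ZMod m, (wsup m d (mk2 m X ^ k.val * u)).card = d * wt2 m u := by
  simp only [wsup, Finset.card_filter, cf_shift_pow, ZMod.natCast_val, ZMod.cast_id', id]
  rw [Finset.sum_comm]
  have : ∀ i ∈ win m d, (∑ k : ZMod m, if cf m u (i - k) ≠ 0 then 1 else 0) = wt2 m u := by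
    intro i _
    rw [wt2_eq, Finset.card_filter]
    exact Equiv.sum_comp (Equiv.subLeft i) (fun k => if cf m u k ≠ 0 then 1 else 0)
  rw [Finset.sum_congr rfl this, Finset.sum_const, win_card m d hd, smul_eq_mul]

lemma dvd_rep2 (m : ℕ) (g : Polynomial (ZMod 2)) (hg : g ∣ fm m) (u : R2 m)
    (hu : u ∈ Ideal.span {mk2 m g}) : g ∣ rep2 m u := by
  rw [Ideal.mem_span_singleton] at hu
  obtain ⟨w, rfl⟩ := hu
  obtain ⟨w, rfl⟩ := mk2_surj m w
  have h : fm m ∣ rep2 m (mk2 m g * mk2 m w) - g * w := by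
    rw [← mk2_eq_zero_iff, map_sub, mk2_rep2, map_mul, sub_self]
  have := dvd_add (hg.trans h) (dvd_mul_right g w)
  simpa using this

lemma wsup_inj (m d : ℕ) [NeZero m] (hd : d ≤ m) (g : Polynomial (ZMod 2)) (hg : g ∣ fm m)
    (hdeg : g.natDegree = m - d) (u v : R2 m) (hu : u ∈ Ideal.span {mk2 m g})
    (hv : v ∈ Ideal.span {mk2 m g}) (h : wsup m d u = wsup m d v) : u = v := by
  have hg0 : g ≠ 0 := by
    rintro rfl
    exact (fm_monic m (NeZero.ne m)).ne_zero (zero_dvd_iff.1 hg)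
  have h1 : g ∣ rep2 m u - rep2 m v := dvd_sub (dvd_rep2 m g hg u hu) (dvd_rep2 m g hg v hv)
  have h2 : rep2 m u - rep2 m v = 0 := by
    apply eq_zero_of_dvd_of_degree_lt h1
    rw [degree_eq_natDegree hg0, hdeg, degree_lt_iff_coeff_zero]
    intro n hn
    rw [coeff_sub, sub_eq_zero]
    by_cases hnm : n < m
    · have hmem : ((n : ZMod m)) ∈ win m d := by
        simp [win, ZMod.val_natCast, Nat.mod_eq_of_lt hnm]; omega
      have h3 : ((n : ZMod m)) ∈ wsup m d u ↔ ((n : ZMod m)) ∈ wsup m d v := by rw [h]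
      unfold wsup at h3
      rw [Finset.mem_filter, Finset.mem_filter] at h3
      simp only [hmem, true_and, cf, ZMod.val_natCast,
        Nat.mod_eq_of_lt hnm] at h3
      revert h3
      generalize (rep2 m u).coeff n = a
      generalize (rep2 m v).coeff n = b
      revert a b
      decide
    · push Not at hnm
      have key : ∀ w : R2 m, (rep2 m w).coeff n = 0 := fun w =>
        coeff_eq_zero_of_degree_lt (lt_of_lt_of_le (rep2_degree m (NeZero.ne m) w) (by exact_mod_cast hnm))
      rw [key, key]
  rw [← mk2_rep2 m u, ← mk2_rep2 m v, sub_eq_zero.1 h2]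

open Classical in
lemma mgf (m d : ℕ) [NeZero m] (hd : d ≤ m) (g : Polynomial (ZMod 2)) (hg : g ∣ fm m)
    (hdeg : g.natDegree = m - d) (s : ℝ) (hs : 0 < s) :
    ∑ u ∈ Finset.univ.filter (fun u : R2 m => u ∈ Ideal.span {mk2 m g}),
      s ^ ((d : ℝ) / m * wt2 m u) ≤ (1 + s) ^ d := by
  set I := Finset.univ.filter (fun u : R2 m => u ∈ Ideal.span {mk2 m g}) with hI
  have hm : (0 : ℝ) < m := by exact_mod_cast Nat.pos_of_ne_zero (NeZero.ne m)
  have hXm : mk2 m X ^ m = 1 := by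
    have : mk2 m (X ^ m - 1) = 0 := (mk2_eq_zero_iff m (fm m)).2 dvd_rfl
    rw [map_sub, map_pow, map_one] at this
    exact sub_eq_zero.1 this
  have step1 : ∀ u : R2 m, s ^ ((d : ℝ) / m * wt2 m u) ≤
      ∑ k : ZMod m, (1 / (m : ℝ)) * s ^ (wsup m d (mk2 m X ^ k.val * u)).card := by
    intro u
    have := Real.geom_mean_le_arith_mean_weighted (Finset.univ : Finset (ZMod m))
      (fun _ => 1 / (m : ℝ)) (fun k => s ^ (wsup m d (mk2 m X ^ k.val * u)).card)
      (fun _ _ => by positivity) (by simp [ZMod.card]) (fun _ _ => by positivity)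
    refine le_trans (le_of_eq ?_) this
    rw [Real.finsetProd_rpow _ _ (fun _ _ => by positivity), Finset.prod_pow_eq_pow_sum,
      sum_wsup m d hd, ← Real.rpow_natCast, ← Real.rpow_mul hs.le]
    congr 1
    push_cast; ring
  have step2 : ∀ k : ZMod m, ∑ u ∈ I, s ^ (wsup m d (mk2 m X ^ k.val * u)).card
      = ∑ u ∈ I, s ^ (wsup m d u).card := by
    intro k
    have hinv : mk2 m X ^ k.val * mk2 m X ^ (m - k.val) = 1 := by
      rw [← pow_add, Nat.add_sub_cancel' (ZMod.val_lt k).le, hXm]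
    apply Finset.sum_nbij' (fun u => mk2 m X ^ k.val * u) (fun u => mk2 m X ^ (m - k.val) * u)
    · intro u hu
      simp only [hI, Finset.mem_filter, Finset.mem_univ, true_and] at hu ⊢
      exact Ideal.mul_mem_left _ _ hu
    · intro u hu
      simp only [hI, Finset.mem_filter, Finset.mem_univ, true_and] at hu ⊢
      exact Ideal.mul_mem_left _ _ hu
    · intro u _
      rw [← mul_assoc, mul_comm (mk2 m X ^ (m - k.val)), hinv, one_mul]
    · intro u _
      rw [← mul_assoc, hinv, one_mul]
    · intro u _; rfl
  have step3 : ∑ u ∈ I, s ^ (wsup m d u).card ≤ (1 + s) ^ d := by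
    have h1 : ∑ u ∈ I, s ^ (wsup m d u).card = ∑ B ∈ I.image (wsup m d), s ^ B.card := by
      rw [Finset.sum_image]
      intro u hu v hv h
      simp only [hI, Finset.coe_filter, Finset.mem_univ, true_and, Set.mem_ofPred_eq] at hu hv
      exact wsup_inj m d hd g hg hdeg u v hu hv h
    rw [h1]
    have h2 : (1 + s) ^ d = ∑ B ∈ (win m d).powerset, s ^ B.card := by
      have := Finset.prod_one_add (f := fun _ : ZMod m => s) (win m d)
      simpa [win_card m d hd] using this
    rw [h2]
    apply Finset.sum_le_sum_of_subset_of_nonneg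
    · intro B hB
      obtain ⟨u, _, rfl⟩ := Finset.mem_image.1 hB
      exact Finset.mem_powerset.2 (Finset.filter_subset _ _)
    · intros; positivity
  calc _ ≤ ∑ u ∈ I, ∑ k : ZMod m, (1 / (m : ℝ)) * s ^ (wsup m d (mk2 m X ^ k.val * u)).card :=
        Finset.sum_le_sum (fun u _ => step1 u)
    _ = ∑ k : ZMod m, (1 / (m : ℝ)) * ∑ u ∈ I, s ^ (wsup m d u).card := by
        rw [Finset.sum_comm]
        refine Finset.sum_congr rfl (fun k _ => ?_)
        rw [← Finset.mul_sum, step2]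
    _ = ∑ u ∈ I, s ^ (wsup m d u).card := by
        rw [Finset.sum_const, Finset.card_univ, ZMod.card, nsmul_eq_mul, ← mul_assoc,
          mul_one_div_cancel hm.ne', one_mul]
    _ ≤ _ := step3

lemma opt_val (α : ℝ) (h0 : 0 < α) (h1 : α < 1/2) :
    (α / (1 - α)) ^ (-α) * (1 + α / (1 - α)) = 2 ^ Hent α := by
  have h2 : 0 < 1 - α := by linarith
  have e1 : 1 + α / (1 - α) = (1 - α)⁻¹ := by field_simp; ring
  have hl : Real.log 2 ≠ 0 := (Real.log_pos (by norm_num)).ne'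
  rw [e1, Real.rpow_def_of_pos (by positivity), Real.rpow_def_of_pos (by norm_num),
    ← Real.exp_log (inv_pos.2 h2), ← Real.exp_add, Real.log_inv, Real.log_div h0.ne' h2.ne', Hent,
    Real.logb, Real.logb]
  congr 1
  field_simp
  ring

open Classical in
lemma pair_count (m d : ℕ) [NeZero m] (hd : d ≤ m) (g : Polynomial (ZMod 2)) (hg : g ∣ fm m)
    (hdeg : g.natDegree = m - d) (α : ℝ) (h0 : 0 < α) (h1 : α < 1/2) :
    (((Finset.univ.filter (fun p : R2 m × R2 m => p.1 ∈ Ideal.span {mk2 m g} ∧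
      p.2 ∈ Ideal.span {mk2 m g} ∧
        ((wt2 m p.1 + wt2 m p.2 : ℕ) : ℝ) ≤ 2 * m * α)).card : ℕ) : ℝ)
      ≤ 2 ^ (2 * d * Hent α) := by
  set I := Finset.univ.filter (fun u : R2 m => u ∈ Ideal.span {mk2 m g}) with hI
  set N := (Finset.univ.filter (fun p : R2 m × R2 m => p.1 ∈ Ideal.span {mk2 m g} ∧
      p.2 ∈ Ideal.span {mk2 m g} ∧ ((wt2 m p.1 + wt2 m p.2 : ℕ) : ℝ) ≤ 2 * m * α)) with hN
  have hm : (0 : ℝ) < m := by exact_mod_cast Nat.pos_of_ne_zero (NeZero.ne m)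
  have h2 : 0 < 1 - α := by linarith
  set s := α / (1 - α) with hs
  have hs0 : 0 < s := by positivity
  have hs1 : s ≤ 1 := by rw [hs, div_le_one h2]; linarith
  have hM := mgf m d hd g hg hdeg s hs0
  rw [← hI] at hM
  set S := ∑ u ∈ I, s ^ ((d : ℝ) / m * wt2 m u) with hS
  have hS0 : 0 ≤ S := Finset.sum_nonneg (fun _ _ => by positivity)
  have key : (N.card : ℝ) * s ^ (2 * d * α) ≤ S * S := by
    calc (N.card : ℝ) * s ^ (2 * d * α) = ∑ p ∈ N, s ^ (2 * d * α) := by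
          rw [Finset.sum_const, nsmul_eq_mul]
      _ ≤ ∑ p ∈ N, s ^ ((d : ℝ) / m * wt2 m p.1) * s ^ ((d : ℝ) / m * wt2 m p.2) := by
          apply Finset.sum_le_sum
          intro p hp
          simp only [hN, Finset.mem_filter, Finset.mem_univ, true_and] at hp
          rw [← Real.rpow_add hs0]
          apply Real.rpow_le_rpow_of_exponent_ge hs0 hs1
          have := mul_le_mul_of_nonneg_left hp.2.2 (show (0:ℝ) ≤ d / m by positivity)
          push_cast at this
          calc _ = (d : ℝ) / m * (wt2 m p.1 + wt2 m p.2) := by ring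
            _ ≤ _ := this
            _ = _ := by field_simp
      _ ≤ ∑ p ∈ I ×ˢ I, s ^ ((d : ℝ) / m * wt2 m p.1) * s ^ ((d : ℝ) / m * wt2 m p.2) := by
          apply Finset.sum_le_sum_of_subset_of_nonneg
          · intro p hp
            simp only [hN, hI, Finset.mem_filter, Finset.mem_univ, true_and,
              Finset.mem_product] at hp ⊢
            exact ⟨hp.1, hp.2.1⟩
          · intros; positivity
      _ = S * S := by rw [Finset.sum_product, hS, Finset.sum_mul_sum]
  have hval : (2 : ℝ) ^ (2 * d * Hent α) * s ^ (2 * d * α) = (1 + s) ^ d * (1 + s) ^ d := by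
    rw [show 2 * (d:ℝ) * Hent α = Hent α * ((2 * d : ℕ) : ℝ) by push_cast; ring,
      Real.rpow_mul (by norm_num), ← opt_val α h0 h1, ← hs, Real.rpow_natCast, mul_pow,
      ← Real.rpow_natCast (s ^ (-α)), ← Real.rpow_mul hs0.le, mul_right_comm, ← Real.rpow_add hs0,
      show -α * ((2 * d : ℕ) : ℝ) + 2 * d * α = 0 by push_cast; ring, Real.rpow_zero, one_mul,
      ← pow_add]
    congr 1; ring
  have hp : 0 < s ^ (2 * d * α) := by positivity
  refine le_of_mul_le_mul_right ?_ hp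
  rw [hval]
  exact key.trans (mul_le_mul hM hM hS0 (by positivity))

lemma geom_mul (m : ℕ) : (X - 1) * geomPoly m = fm m := by
  unfold geomPoly fm
  exact mul_geom_sum X m

lemma geom_ne_zero (m : ℕ) [NeZero m] : geomPoly m ≠ 0 := by
  intro h
  have := geom_mul m
  rw [h, mul_zero] at this
  exact (fm_monic m (NeZero.ne m)).ne_zero this.symm

lemma mem_Jm_dvd (m : ℕ) [NeZero m] (c : R2 m) (hc : c ∈ Jm m) : (X - 1) ∣ rep2 m c :=
  dvd_rep2 m (X - 1) ⟨_, (geom_mul m).symm⟩ c hc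

lemma geom_mul_Jm (m : ℕ) (a : R2 m) (ha : a ∈ Jm m) : mk2 m (geomPoly m) * a = 0 := by
  rw [Jm, Ideal.mem_span_singleton] at ha
  obtain ⟨w, rfl⟩ := ha
  rw [← mul_assoc, ← map_mul, mul_comm (geomPoly m), geom_mul, (mk2_eq_zero_iff m (fm m)).2 dvd_rfl,
    zero_mul]

/-- identity of J -/
def eJ (m : ℕ) : R2 m := mk2 m (1 + geomPoly m)

lemma eJ_mem (m : ℕ) (hm : Odd m) : eJ m ∈ Jm m := by
  rw [Jm, Ideal.mem_span_singleton]
  apply _root_.map_dvd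
  have : (X - C (1 : ZMod 2)) ∣ 1 + geomPoly m := by
    rw [dvd_iff_isRoot, IsRoot]
    have h : ((m : ℕ) : ZMod 2) = 1 := by
      rw [ZMod.natCast_eq_one_iff_odd]; exact hm
    simp [geomPoly, eval_finsetSum, h]
    decide
  simpa using this

lemma eJ_mul (m : ℕ) (a : R2 m) (ha : a ∈ Jm m) : eJ m * a = a := by
  rw [eJ, map_add, add_mul, geom_mul_Jm m a ha, map_one, one_mul, add_zero]

open Classical in
/-- the distinct irreducible factors -/
def TT (m : ℕ) : Finset (Polynomial (ZMod 2)) :=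
  (UniqueFactorizationMonoid.normalizedFactors (geomPoly m)).toFinset

open Classical in
def gS (m : ℕ) (S : Finset (Polynomial (ZMod 2))) : Polynomial (ZMod 2) :=
  (X - 1) * ∏ p ∈ TT m \ S, p

lemma fm_squarefree (m : ℕ) (hm : Odd m) : Squarefree (fm m) := by
  have h : ((m : ℕ) : ZMod 2) ≠ 0 := by
    rw [(ZMod.natCast_eq_one_iff_odd).2 hm]; exact one_ne_zero
  have := (separable_X_pow_sub_C (1 : ZMod 2) h one_ne_zero).squarefree
  simpa [fm] using this

lemma TT_spec (m : ℕ) [NeZero m] (p : Polynomial (ZMod 2)) (hp : p ∈ TT m) :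
    Irreducible p ∧ p ∣ geomPoly m := by
  classical
  rw [TT, Multiset.mem_toFinset] at hp
  exact ⟨UniqueFactorizationMonoid.irreducible_of_normalized_factor _ hp,
    UniqueFactorizationMonoid.dvd_of_mem_normalizedFactors hp⟩

lemma divisor_prod (m : ℕ) [NeZero m] (hm : Odd m) (h : Polynomial (ZMod 2)) (hh : h ∣ geomPoly m) :
    ∃ U ⊆ TT m, Associated (∏ p ∈ U, p) h := by
  classical
  have h0 : h ≠ 0 := fun h0 => geom_ne_zero m (zero_dvd_iff.1 (h0 ▸ hh))
  have hsq : Squarefree h := (fm_squarefree m hm).squarefree_of_dvd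
    (hh.trans ⟨_, ((mul_comm _ _).trans (geom_mul m)).symm⟩)
  refine ⟨(UniqueFactorizationMonoid.normalizedFactors h).toFinset, ?_, ?_⟩
  · intro p hp
    rw [TT, Multiset.mem_toFinset]
    rw [Multiset.mem_toFinset] at hp
    exact Multiset.mem_of_le
      ((UniqueFactorizationMonoid.dvd_iff_normalizedFactors_le_normalizedFactors h0
        (geom_ne_zero m)).1 hh) hp
  · have hnd := (UniqueFactorizationMonoid.squarefree_iff_nodup_normalizedFactors h0).1 hsq
    have := UniqueFactorizationMonoid.prod_normalizedFactors h0
    rw [Finset.prod, Multiset.toFinset_val, hnd.dedup, Multiset.map_id']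
    exact this

lemma assoc_eq {p q : Polynomial (ZMod 2)} (h : Associated p q) : p = q := by
  by_cases hp : p = 0
  · subst hp; exact ((associated_zero_iff_eq_zero q).1 h.symm).symm
  have hq : q ≠ 0 := fun hq => hp ((associated_zero_iff_eq_zero p).1 (hq ▸ h))
  have key : ∀ r : Polynomial (ZMod 2), r ≠ 0 → r.Monic := by
    intro r hr
    have h2 : ∀ a : ZMod 2, a ≠ 0 → a = 1 := by decide
    exact h2 _ (leadingCoeff_ne_zero.2 hr)
  exact eq_of_monic_of_associated (key p hp) (key q hq) h

lemma TT_prod (m : ℕ) [NeZero m] (hm : Odd m) : ∏ p ∈ TT m, p = geomPoly m := by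
  classical
  have h0 := geom_ne_zero m
  have hsq : Squarefree (geomPoly m) := (fm_squarefree m hm).squarefree_of_dvd
    ⟨_, ((mul_comm _ _).trans (geom_mul m)).symm⟩
  have hnd := (UniqueFactorizationMonoid.squarefree_iff_nodup_normalizedFactors h0).1 hsq
  have := UniqueFactorizationMonoid.prod_normalizedFactors h0
  rw [Finset.prod, TT, Multiset.toFinset_val, hnd.dedup, Multiset.map_id']
  exact assoc_eq this

lemma gS_mul (m : ℕ) [NeZero m] (hm : Odd m) (S : Finset (Polynomial (ZMod 2))) (hS : S ⊆ TT m) :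
    gS m S * ∏ p ∈ S, p = fm m := by
  classical
  rw [gS, mul_assoc, Finset.prod_sdiff hS, TT_prod m hm, geom_mul]

lemma ideal_class (m : ℕ) [NeZero m] (hm : Odd m) (c : R2 m) (hc : c ∈ Jm m) (hc0 : c ≠ 0) :
    ∃ S ⊆ TT m, S ≠ ∅ ∧ Ideal.span {c} = Ideal.span {mk2 m (gS m S)} := by
  classical
  set r := rep2 m c with hr
  have hcr : mk2 m r = c := mk2_rep2 m c
  set g := EuclideanDomain.gcd r (fm m) with hg
  have hX0 : (X - 1 : Polynomial (ZMod 2)) ≠ 0 := by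
    have := X_sub_C_ne_zero (1 : ZMod 2)
    simpa using this
  have hXg : (X - 1) ∣ g := EuclideanDomain.dvd_gcd (mem_Jm_dvd m c hc) ⟨_, (geom_mul m).symm⟩
  obtain ⟨g', hg'⟩ := hXg
  have hgg : g' ∣ geomPoly m := by
    have : (X - 1) * g' ∣ (X - 1) * geomPoly m := by
      rw [← hg', geom_mul]; exact EuclideanDomain.gcd_dvd_right _ _
    exact (mul_dvd_mul_iff_left hX0).1 this
  obtain ⟨U, hU, hUa⟩ := divisor_prod m hm g' hgg
  have hUa := assoc_eq hUa
  have hgU : gS m (TT m \ U) = g := by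
    rw [gS, Finset.sdiff_sdiff_eq_self hU, hUa, hg']
  refine ⟨TT m \ U, Finset.sdiff_subset, ?_, ?_⟩
  · intro he
    have h1 := gS_mul m hm (TT m \ U) Finset.sdiff_subset
    rw [hgU, he, Finset.prod_empty, mul_one] at h1
    apply hc0
    rw [← hcr, mk2_eq_zero_iff, ← h1]
    exact EuclideanDomain.gcd_dvd_left _ _
  · rw [hgU]
    apply le_antisymm
    · rw [Ideal.span_singleton_le_span_singleton, ← hcr]
      exact _root_.map_dvd _ (EuclideanDomain.gcd_dvd_left _ _)
    · rw [Ideal.span_singleton_le_span_singleton]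
      refine ⟨mk2 m (EuclideanDomain.gcdA r (fm m)), ?_⟩
      rw [hg, EuclideanDomain.gcd_eq_gcd_ab r (fm m), map_add, map_mul, map_mul,
        (mk2_eq_zero_iff m (fm m)).2 dvd_rfl, zero_mul, add_zero, hcr]

open Classical in
lemma ideal_card_ge (m : ℕ) [NeZero m] (g h : Polynomial (ZMod 2)) (hgh : g * h = fm m) :
    2 ^ h.natDegree ≤ (Finset.univ.filter (fun u : R2 m => u ∈ Ideal.span {mk2 m g})).card := by
  have hf0 : fm m ≠ 0 := (fm_monic m (NeZero.ne m)).ne_zero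
  have hg0 : g ≠ 0 := by rintro rfl; exact hf0 (by rw [← hgh, zero_mul])
  have hh0 : h ≠ 0 := by rintro rfl; exact hf0 (by rw [← hgh, mul_zero])
  have hdeg : ∀ v : degreeLT (ZMod 2) h.natDegree, (g * v.1).degree < (fm m).degree := by
    intro v
    rw [← hgh, degree_mul, degree_mul]
    have hv := mem_degreeLT.1 v.2
    rw [← degree_eq_natDegree hh0] at hv
    rw [degree_eq_natDegree hg0]
    exact WithBot.add_lt_add_left (by simp) hv
  have h1 : 2 ^ h.natDegree = (Finset.univ : Finset (Fin h.natDegree → ZMod 2)).card := by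
    simp
  rw [h1]
  apply Finset.card_le_card_of_injOn
    (fun w => mk2 m (g * ((degreeLTEquiv (ZMod 2) h.natDegree).symm w).1))
  · intro w _
    simp only [Finset.coe_filter, Finset.mem_univ, true_and, Set.mem_ofPred_eq]
    rw [Ideal.mem_span_singleton, map_mul]
    exact dvd_mul_right _ _
  · intro w _ w' _ hw
    have h2 : fm m ∣ g * ((degreeLTEquiv (ZMod 2) h.natDegree).symm w).1
      - g * ((degreeLTEquiv (ZMod 2) h.natDegree).symm w').1 := by
      rw [← mk2_eq_zero_iff, map_sub, sub_eq_zero]; exact hw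
    have h3 := eq_zero_of_dvd_of_degree_lt h2
      (lt_of_le_of_lt (degree_sub_le _ _) (max_lt (hdeg _) (hdeg _)))
    have h4 := mul_left_cancel₀ hg0 (sub_eq_zero.1 h3)
    exact (degreeLTEquiv (ZMod 2) h.natDegree).symm.injective (Subtype.ext h4)

open Classical in
/-- ideal J as finset -/
def JF (m : ℕ) [NeZero m] : Finset (R2 m) := Finset.univ.filter (fun u => u ∈ Jm m)

open Classical in
def IF (m : ℕ) [NeZero m] (I : Ideal (R2 m)) : Finset (R2 m) := Finset.univ.filter (fun u => u ∈ I)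

open Classical in
lemma fiber_card (m : ℕ) [NeZero m] (hm : Odd m) (c : R2 m) (u : R2 m)
    (hu : u ∈ Ideal.span {c}) :
    ((JF m).filter (fun a => c * a = u)).card = ((JF m).filter (fun a => c * a = 0)).card ∨
      c ∉ Jm m := by
  by_cases hc : c ∈ Jm m
  swap
  · exact Or.inr hc
  left
  obtain ⟨w, rfl⟩ := Ideal.mem_span_singleton.1 hu
  have he : c * (eJ m * w) = c * w := by
    rw [← mul_assoc, mul_comm c, eJ_mul m c hc]
  have hew : eJ m * w ∈ Jm m := Ideal.mul_mem_right _ _ (eJ_mem m hm)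
  apply Finset.card_nbij' (fun a => a - eJ m * w) (fun a => a + eJ m * w)
  · intro a ha
    simp only [JF, Finset.coe_filter, Finset.mem_filter, Finset.mem_univ, true_and,
      Set.mem_ofPred_eq] at ha ⊢
    exact ⟨sub_mem ha.1 hew, by rw [mul_sub, ha.2, he, sub_self]⟩
  · intro a ha
    simp only [JF, Finset.coe_filter, Finset.mem_filter, Finset.mem_univ, true_and,
      Set.mem_ofPred_eq] at ha ⊢
    exact ⟨add_mem ha.1 hew, by rw [mul_add, ha.2, he, zero_add]⟩
  · intro a _; simp
  · intro a _; simp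

open Classical in
lemma bad_c (m : ℕ) [NeZero m] (hm : Odd m) (c : R2 m) (hc : c ∈ Jm m) (L : Finset (R2 m × R2 m))
    (hL : ∀ p ∈ L, p.1 ∈ Ideal.span {c} ∧ p.2 ∈ Ideal.span {c}) :
    ((JF m ×ˢ JF m).filter (fun p => (c * p.1, c * p.2) ∈ L)).card * (IF m (Ideal.span {c})).card ^ 2
      = L.card * (JF m).card ^ 2 := by
  set K := ((JF m).filter (fun a => c * a = 0)).card with hK
  have hfib : ∀ u ∈ Ideal.span {c}, ((JF m).filter (fun a => c * a = u)).card = K := by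
    intro u hu
    rcases fiber_card m hm c u hu with h | h
    · exact h
    · exact absurd hc h
  have hJ : (JF m).card = (IF m (Ideal.span {c})).card * K := by
    rw [Finset.card_eq_sum_card_fiberwise (f := fun a => c * a) (t := IF m (Ideal.span {c}))]
    · rw [Finset.sum_congr rfl (fun u hu => hfib u (by simpa [IF] using hu)), Finset.sum_const,
        smul_eq_mul]
    · intro a _
      simp only [IF, Finset.coe_filter, Finset.mem_univ, true_and, Set.mem_ofPred_eq]
      exact Ideal.mem_span_singleton.2 (dvd_mul_right _ _)
  have hB : ((JF m ×ˢ JF m).filter (fun p => (c * p.1, c * p.2) ∈ L)).card = L.card * K ^ 2 := by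
    rw [Finset.card_eq_sum_card_fiberwise (f := fun p => (c * p.1, c * p.2)) (t := L)]
    · rw [Finset.sum_congr rfl (g := fun _ => K ^ 2), Finset.sum_const, smul_eq_mul]
      intro q hq
      obtain ⟨h1, h2⟩ := hL q hq
      rw [sq]
      nth_rewrite 1 [← hfib _ h1]
      rw [← hfib _ h2, ← Finset.card_product]
      congr 1
      ext ⟨a, b⟩
      simp only [Finset.mem_filter, Finset.mem_product, Prod.ext_iff]
      constructor
      · rintro ⟨⟨⟨ha, hb⟩, _⟩, h3, h4⟩
        exact ⟨⟨ha, h3⟩, hb, h4⟩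
      · rintro ⟨⟨ha, h3⟩, hb, h4⟩
        refine ⟨⟨⟨ha, hb⟩, ?_⟩, h3, h4⟩
        rw [h3, h4]; exact hq
    · intro p hp
      exact (Finset.mem_filter.1 hp).2
  rw [hB, hJ]; ring

open Classical in
lemma bad_bound (m : ℕ) [NeZero m] (hm : Odd m) (α : ℝ) (h0 : 0 < α) (h1 : α < 1/2) :
    ((((JF m ×ˢ JF m).filter (fun p => ∃ c : R2 m, (c * p.1 ≠ 0 ∨ c * p.2 ≠ 0) ∧
      ((wt2 m (c * p.1) + wt2 m (c * p.2) : ℕ) : ℝ) ≤ 2 * m * α)).card : ℕ) : ℝ) ≤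
    ((JF m).card : ℝ) ^ 2 * (∏ p ∈ TT m, (1 + (2 : ℝ) ^ (-(1 - 2 * Hent α) * p.natDegree)) - 1) := by
  set Bad := (JF m ×ˢ JF m).filter (fun p => ∃ c : R2 m, (c * p.1 ≠ 0 ∨ c * p.2 ≠ 0) ∧
      ((wt2 m (c * p.1) + wt2 m (c * p.2) : ℕ) : ℝ) ≤ 2 * m * α) with hBad
  let L : Finset (Polynomial (ZMod 2)) → Finset (R2 m × R2 m) := fun S =>
    Finset.univ.filter (fun p : R2 m × R2 m => p.1 ∈ Ideal.span {mk2 m (gS m S)} ∧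
      p.2 ∈ Ideal.span {mk2 m (gS m S)} ∧
        ((wt2 m p.1 + wt2 m p.2 : ℕ) : ℝ) ≤ 2 * m * α)
  let D : Finset (Polynomial (ZMod 2)) → Finset (R2 m) := fun S =>
    (IF m (Ideal.span {mk2 m (gS m S)})).filter
      (fun c => c ∈ Jm m ∧ Ideal.span {c} = Ideal.span {mk2 m (gS m S)})
  let B : Finset (Polynomial (ZMod 2)) → R2 m → Finset (R2 m × R2 m) := fun S c =>
    (JF m ×ˢ JF m).filter (fun p => (c * p.1, c * p.2) ∈ L S)
  have hsub : Bad ⊆ ((TT m).powerset.erase ∅).biUnion (fun S => (D S).biUnion (fun c => B S c)) := by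
    intro p hp
    obtain ⟨hpJ, c, hne, hw⟩ := Finset.mem_filter.1 hp
    have hpJ' := Finset.mem_product.1 hpJ
    have hp1 : p.1 ∈ Jm m := by simpa [JF] using hpJ'.1
    have hp2 : p.2 ∈ Jm m := by simpa [JF] using hpJ'.2
    set c' := c * eJ m with hc'
    have e1 : c' * p.1 = c * p.1 := by rw [hc', mul_assoc, eJ_mul m _ hp1]
    have e2 : c' * p.2 = c * p.2 := by rw [hc', mul_assoc, eJ_mul m _ hp2]
    have hcJ : c' ∈ Jm m := Ideal.mul_mem_left _ _ (eJ_mem m hm)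
    have hc0 : c' ≠ 0 := by
      intro h
      rw [h, zero_mul] at e1 e2
      rcases hne with h | h
      · exact h e1.symm
      · exact h e2.symm
    obtain ⟨S, hS, hS0, hSp⟩ := ideal_class m hm c' hcJ hc0
    simp only [Finset.mem_biUnion]
    refine ⟨S, Finset.mem_erase.2 ⟨hS0, Finset.mem_powerset.2 hS⟩, c', ?_, ?_⟩
    · refine Finset.mem_filter.2 ⟨?_, hcJ, hSp⟩
      refine Finset.mem_filter.2 ⟨Finset.mem_univ _, ?_⟩
      rw [← hSp]; exact Ideal.mem_span_singleton_self c'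
    · refine Finset.mem_filter.2 ⟨hpJ, Finset.mem_filter.2 ⟨Finset.mem_univ _, ?_, ?_, ?_⟩⟩
      · rw [← hSp]; exact Ideal.mem_span_singleton.2 (dvd_mul_right _ _)
      · rw [← hSp]; exact Ideal.mem_span_singleton.2 (dvd_mul_right _ _)
      · simp only [e1, e2]; exact hw
  have hS : ∀ S ∈ (TT m).powerset.erase ∅, (((D S).biUnion (fun c => B S c)).card : ℝ) ≤
      ((JF m).card : ℝ) ^ 2 * ∏ p ∈ S, (2 : ℝ) ^ (-(1 - 2 * Hent α) * p.natDegree) := by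
    intro S hS
    have hST : S ⊆ TT m := Finset.mem_powerset.1 (Finset.mem_erase.1 hS).2
    have hgh := gS_mul m hm S hST
    set h := ∏ p ∈ S, p with hh
    have hf0 : fm m ≠ 0 := (fm_monic m (NeZero.ne m)).ne_zero
    have hg0 : gS m S ≠ 0 := by intro h; exact hf0 (by rw [← hgh, h, zero_mul])
    have hh0 : h ≠ 0 := by intro h; exact hf0 (by rw [← hgh, h, mul_zero])
    have hdd : (gS m S).natDegree + h.natDegree = m := by
      rw [← natDegree_mul hg0 hh0, hgh, fm_natDegree]
    have hLc := pair_count m h.natDegree (by omega) (gS m S) ⟨_, hgh.symm⟩ (by omega) α h0 h1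
    have hIc := ideal_card_ge m (gS m S) h hgh
    set I := IF m (Ideal.span {mk2 m (gS m S)}) with hI
    change 2 ^ h.natDegree ≤ I.card at hIc
    change ((L S).card : ℝ) ≤ _ at hLc
    have hIc' : (2 : ℝ) ^ (h.natDegree : ℝ) ≤ I.card := by
      rw [Real.rpow_natCast]; exact_mod_cast hIc
    have hIpos : (0 : ℝ) < I.card := lt_of_lt_of_le (by positivity) hIc'
    have hBc : ∀ c ∈ D S, ((B S c).card : ℝ) = (L S).card * ((JF m).card : ℝ) ^ 2 / I.card ^ 2 := by
      intro c hc
      obtain ⟨_, hcJ, hsp⟩ := Finset.mem_filter.1 hc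
      have := bad_c m hm c hcJ (L S) (by
        intro p hp
        have := (Finset.mem_filter.1 hp).2
        rw [hsp]; exact ⟨this.1, this.2.1⟩)
      rw [hsp] at this
      rw [eq_div_iff (by positivity)]
      exact_mod_cast this
    have hdegS : (∏ p ∈ S, (2 : ℝ) ^ (-(1 - 2 * Hent α) * p.natDegree))
        = 2 ^ (-(1 - 2 * Hent α) * h.natDegree) := by
      rw [hh, natDegree_prod _ _ (fun p hp => (TT_spec m p (hST hp)).1.ne_zero),
        ← Real.rpow_sum_of_pos (by norm_num)]
      push_cast
      rw [Finset.mul_sum]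
    rw [hdegS]
    calc (((D S).biUnion (fun c => B S c)).card : ℝ) ≤ ∑ c ∈ D S, ((B S c).card : ℝ) := by
          exact_mod_cast Finset.card_biUnion_le
      _ = (D S).card * ((L S).card * ((JF m).card : ℝ) ^ 2 / I.card ^ 2) := by
          rw [Finset.sum_congr rfl hBc, Finset.sum_const, nsmul_eq_mul]
      _ ≤ I.card * ((L S).card * ((JF m).card : ℝ) ^ 2 / I.card ^ 2) := by
          gcongr
          exact Finset.filter_subset _ _
      _ = ((JF m).card : ℝ) ^ 2 * ((L S).card / I.card) := by field_simp
      _ ≤ ((JF m).card : ℝ) ^ 2 * (2 ^ (2 * h.natDegree * Hent α) / 2 ^ (h.natDegree : ℝ)) := by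
          gcongr
      _ = _ := by
          rw [← Real.rpow_sub (by norm_num)]
          congr 2; ring
  calc (Bad.card : ℝ) ≤ ((((TT m).powerset.erase ∅).biUnion
        (fun S => (D S).biUnion (fun c => B S c))).card : ℝ) := by
        exact_mod_cast Finset.card_le_card hsub
    _ ≤ ∑ S ∈ (TT m).powerset.erase ∅, (((D S).biUnion (fun c => B S c)).card : ℝ) := by
        exact_mod_cast Finset.card_biUnion_le
    _ ≤ ∑ S ∈ (TT m).powerset.erase ∅,
        ((JF m).card : ℝ) ^ 2 * ∏ p ∈ S, (2 : ℝ) ^ (-(1 - 2 * Hent α) * p.natDegree) :=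
        Finset.sum_le_sum hS
    _ = _ := by
        rw [← Finset.mul_sum, Finset.prod_one_add,
          ← Finset.sum_erase_add _ _ (Finset.empty_mem_powerset (TT m)), Finset.prod_empty,
          add_sub_cancel_right]

lemma TT_card (m : ℕ) [NeZero m] (hm : Odd m) : (TT m).card ≤ m := by
  have h1 : (geomPoly m).natDegree ≤ m := by
    have h2 := natDegree_le_of_dvd (Dvd.intro_left _ (geom_mul m))
      (fm_monic m (NeZero.ne m)).ne_zero
    rwa [fm_natDegree m] at h2
  rw [← TT_prod m hm, natDegree_prod _ _ (fun p hp => (TT_spec m p hp).1.ne_zero)] at h1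
  refine le_trans ?_ h1
  rw [Finset.card_eq_sum_ones]
  exact Finset.sum_le_sum (fun p hp => (TT_spec m p hp).1.natDegree_pos)

lemma prod_bound (m : ℕ) [NeZero m] (hm : Odd m) (ε : ℝ) (hε : 0 < ε) :
    ∏ p ∈ TT m, (1 + (2 : ℝ) ^ (-ε * p.natDegree)) ≤ Real.exp (m * (2 : ℝ) ^ (-ε * ell m)) := by
  calc ∏ p ∈ TT m, (1 + (2 : ℝ) ^ (-ε * p.natDegree))
      ≤ ∏ p ∈ TT m, Real.exp ((2 : ℝ) ^ (-ε * ell m)) := by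
        apply Finset.prod_le_prod
        · intros; positivity
        · intro p hp
          have hl : ell m ≤ p.natDegree :=
            Nat.sInf_le ⟨p, (TT_spec m p hp).1, (TT_spec m p hp).2, rfl⟩
          have hl' : (ell m : ℝ) ≤ p.natDegree := by exact_mod_cast hl
          have : (2 : ℝ) ^ (-ε * p.natDegree) ≤ (2 : ℝ) ^ (-ε * ell m) := by
            apply Real.rpow_le_rpow_of_exponent_le (by norm_num)
            nlinarith
          have h2 := Real.add_one_le_exp ((2 : ℝ) ^ (-ε * ell m))
          linarith
    _ = Real.exp ((TT m).card * (2 : ℝ) ^ (-ε * ell m)) := by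
        rw [Finset.prod_const, ← Real.exp_nat_mul]
    _ ≤ _ := by
        apply Real.exp_le_exp.2
        gcongr
        exact TT_card m hm

lemma ell_pos (m : ℕ) (hm : 2 ≤ m) : 0 < ell m := by
  have : NeZero m := ⟨by omega⟩
  have hdeg : (geomPoly m).natDegree + 1 = m := by
    have h := congrArg natDegree (geom_mul m)
    have hX : (X - 1 : Polynomial (ZMod 2)) = X - C 1 := by simp
    rw [natDegree_mul (by rw [hX]; exact X_sub_C_ne_zero 1) (geom_ne_zero m), fm_natDegree, hX,
      natDegree_X_sub_C] at h
    omega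
  have hnu : ¬ IsUnit (geomPoly m) := by
    intro h
    have := natDegree_eq_zero_of_isUnit h
    omega
  obtain ⟨p, hp, hpd⟩ := WfDvdMonoid.exists_irreducible_factor hnu (geom_ne_zero m)
  have := Nat.sInf_mem (s := {d | ∃ p : Polynomial (ZMod 2), Irreducible p ∧ p ∣ geomPoly m ∧
    p.natDegree = d}) ⟨_, p, hp, hpd, rfl⟩
  obtain ⟨q, hq, _, hqd⟩ := this
  change q.natDegree = ell m at hqd
  rw [← hqd]
  exact hq.natDegree_pos

open Classical in
lemma frac_bounds (m : ℕ) [NeZero m] (hm : Odd m) (δ : ℝ) (hδ0 : 0 < δ) (hδ1 : δ < 1/3)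
    (hδ2 : Hent (3*δ/2) < 1/2) :
    2 - Real.exp (m * (2 : ℝ) ^ (-(1 - 2 * Hent (3*δ/2)) * ell m)) ≤
     (Nat.card {p : R2 m × R2 m // p.1 ∈ Jm m ∧ p.2 ∈ Jm m ∧
          ∀ c : R2 m, (c * p.1, iota m (c * p.2)) ≠ (0 : R2 m × R4 m) →
            3 * (m : ℝ) * δ
              < ((wt2 m (c * p.1) + 2 * wt2 m (c * p.2) : ℕ) : ℝ)} : ℝ) /
      (Nat.card {p : R2 m × R2 m // p.1 ∈ Jm m ∧ p.2 ∈ Jm m} : ℝ) ∧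
     (Nat.card {p : R2 m × R2 m // p.1 ∈ Jm m ∧ p.2 ∈ Jm m ∧
          ∀ c : R2 m, (c * p.1, iota m (c * p.2)) ≠ (0 : R2 m × R4 m) →
            3 * (m : ℝ) * δ
              < ((wt2 m (c * p.1) + 2 * wt2 m (c * p.2) : ℕ) : ℝ)} : ℝ) /
      (Nat.card {p : R2 m × R2 m // p.1 ∈ Jm m ∧ p.2 ∈ Jm m} : ℝ) ≤ 1 := by
  set P : R2 m × R2 m → Prop := fun p => ∀ c : R2 m, (c * p.1, iota m (c * p.2)) ≠ (0 : R2 m × R4 m) →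
            3 * (m : ℝ) * δ
              < ((wt2 m (c * p.1) + 2 * wt2 m (c * p.2) : ℕ) : ℝ) with hP
  have hB := bad_bound m hm (3*δ/2) (by linarith) (by linarith)
  have hPr := prod_bound m hm (1 - 2 * Hent (3*δ/2)) (by linarith)
  set E := Real.exp (m * (2 : ℝ) ^ (-(1 - 2 * Hent (3*δ/2)) * ell m)) with hE
  set Bad := (JF m ×ˢ JF m).filter (fun p => ∃ c : R2 m, (c * p.1 ≠ 0 ∨ c * p.2 ≠ 0) ∧
      ((wt2 m (c * p.1) + wt2 m (c * p.2) : ℕ) : ℝ) ≤ 2 * m * (3*δ/2)) with hBad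
  have c1 : Nat.card {p : R2 m × R2 m // p.1 ∈ Jm m ∧ p.2 ∈ Jm m} = (JF m ×ˢ JF m).card := by
    rw [Nat.card_eq_fintype_card, Fintype.card_subtype]
    congr 1
    ext p
    simp [JF]
  have c2 : Nat.card {p : R2 m × R2 m // p.1 ∈ Jm m ∧ p.2 ∈ Jm m ∧ P p}
      = ((JF m ×ˢ JF m).filter P).card := by
    rw [Nat.card_eq_fintype_card, Fintype.card_subtype]
    congr 1
    ext p
    simp [JF, and_assoc]
  have c3 := Finset.card_filter_add_card_filter_not (s := JF m ×ˢ JF m) P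
  have hsub : (JF m ×ˢ JF m).filter (fun p => ¬ P p) ⊆ Bad := by
    intro p hp
    obtain ⟨hpJ, hn⟩ := Finset.mem_filter.1 hp
    refine Finset.mem_filter.2 ⟨hpJ, ?_⟩
    simp only [hP] at hn
    push Not at hn
    obtain ⟨c, hne, hw⟩ := hn
    refine ⟨c, ?_, ?_⟩
    · by_contra hcon
      push Not at hcon
      apply hne
      rw [hcon.1, hcon.2, iota_zero m (NeZero.ne m)]; rfl
    · push_cast at hw ⊢
      have : (0 : ℝ) ≤ wt2 m (c * p.2) := by positivity
      linarith
  have c4 := Finset.card_le_card hsub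
  have hJpos : 0 < (JF m).card := Finset.card_pos.2 ⟨0, by simp [JF]⟩
  have hJpos' : (0 : ℝ) < ((JF m ×ˢ JF m).card : ℝ) := by
    rw [Finset.card_product]; positivity
  change _ ≤ (Nat.card {p : R2 m × R2 m // p.1 ∈ Jm m ∧ p.2 ∈ Jm m ∧ P p} : ℝ) / _ ∧
    (Nat.card {p : R2 m × R2 m // p.1 ∈ Jm m ∧ p.2 ∈ Jm m ∧ P p} : ℝ) / _ ≤ 1
  rw [c1, c2]
  have c3' : (((JF m ×ˢ JF m).filter P).card : ℝ) +
    (((JF m ×ˢ JF m).filter (fun p => ¬ P p)).card : ℝ) = ((JF m ×ˢ JF m).card : ℝ) := by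
    exact_mod_cast c3
  have c4' : (((JF m ×ˢ JF m).filter (fun p => ¬ P p)).card : ℝ) ≤ Bad.card := by exact_mod_cast c4
  have hN : ((JF m ×ˢ JF m).card : ℝ) = ((JF m).card : ℝ) ^ 2 := by
    rw [Finset.card_product]; push_cast; ring
  rw [← hN] at hB
  constructor
  · rw [le_div_iff₀ hJpos']
    have : ((JF m ×ˢ JF m).card : ℝ) *
      (∏ p ∈ TT m, (1 + (2 : ℝ) ^ (-(1 - 2 * Hent (3*δ/2)) * p.natDegree)) - 1) ≤
      ((JF m ×ˢ JF m).card : ℝ) * (E - 1) := by gcongr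
    linarith
  · rw [div_le_one hJpos']
    have : (0 : ℝ) ≤ (((JF m ×ˢ JF m).filter (fun p => ¬ P p)).card : ℝ) := by positivity
    linarith

open Filter Topology in
/-- If `m_i` are odd, `m_i → ∞` and `log₂(m_i)/ℓ_{m_i} → 0`, then the
fraction of pairs `(a,b) ∈ J_{m_i} × J_{m_i}` whose code `C_{a,b}` has all nonzero
codewords of weight `> 3 m_i δ` (i.e. `Δ(C_{a,b}) > δ`) tends to `1`. -/
theorem statement10 (ms : ℕ → ℕ) (hodd : ∀ i, Odd (ms i)) (hpos : ∀ i, 0 < ms i)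
    (htop : Tendsto (fun i => (ms i : ℝ)) atTop atTop)
    (hlog : Tendsto (fun i => Real.logb 2 (ms i) / (ell (ms i) : ℝ)) atTop (nhds 0))
    (δ : ℝ) (hδ0 : 0 < δ) (hδ1 : δ < 1/3) (hδ2 : Hent (3*δ/2) < 1/2) :
    Tendsto (fun i =>
      (Nat.card {p : R2 (ms i) × R2 (ms i) // p.1 ∈ Jm (ms i) ∧ p.2 ∈ Jm (ms i) ∧
          ∀ c : R2 (ms i), (c * p.1, iota (ms i) (c * p.2)) ≠ (0 : R2 (ms i) × R4 (ms i)) →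
            3 * (ms i : ℝ) * δ
              < ((wt2 (ms i) (c * p.1) + 2 * wt2 (ms i) (c * p.2) : ℕ) : ℝ)} : ℝ) /
      (Nat.card {p : R2 (ms i) × R2 (ms i) // p.1 ∈ Jm (ms i) ∧ p.2 ∈ Jm (ms i)} : ℝ))
      atTop (nhds 1) := by
  set ε := 1 - 2 * Hent (3*δ/2) with hε
  have hε0 : 0 < ε := by linarith
  have hbd := fun i => @frac_bounds (ms i) ⟨(hpos i).ne'⟩ (hodd i) δ hδ0 hδ1 hδ2
  have hlim : Tendsto (fun i => (ms i : ℝ) * (2 : ℝ) ^ (-ε * ell (ms i))) atTop (nhds 0) := by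
    refine squeeze_zero' (Eventually.of_forall (fun i => by positivity)) ?_
      (tendsto_inv_atTop_zero.comp htop)
    have e1 : ∀ᶠ i in atTop, Real.logb 2 (ms i) / (ell (ms i) : ℝ) < ε / 2 :=
      hlog.eventually (gt_mem_nhds (by linarith))
    filter_upwards [e1, htop.eventually_ge_atTop 2] with i h1 h2
    have h2' : 2 ≤ ms i := by exact_mod_cast h2
    have hl : (0 : ℝ) < ell (ms i) := by exact_mod_cast ell_pos (ms i) h2'
    rw [div_lt_iff₀ hl] at h1
    have hm0 : (0 : ℝ) < ms i := by linarith
    have h3 : (2 : ℝ) ^ (-ε * ell (ms i)) ≤ 2 ^ (-(2 * Real.logb 2 (ms i))) := by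
      apply Real.rpow_le_rpow_of_exponent_le (by norm_num)
      linarith
    have h4 : (2 : ℝ) ^ (-(2 * Real.logb 2 (ms i))) = ((ms i : ℝ) ^ 2)⁻¹ := by
      rw [Real.rpow_neg (by norm_num), mul_comm, Real.rpow_mul (by norm_num),
        Real.rpow_logb (by norm_num) (by norm_num) hm0]
      norm_num
    rw [h4] at h3
    calc _ ≤ (ms i : ℝ) * ((ms i : ℝ) ^ 2)⁻¹ := by gcongr
      _ = _ := by simp only [Function.comp]; field_simp
  have hlim2 : Tendsto (fun i => 2 - Real.exp ((ms i : ℝ) * (2 : ℝ) ^ (-ε * ell (ms i)))) atTop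
      (nhds 1) := by
    have := (Real.continuous_exp.tendsto 0).comp hlim
    have h := (tendsto_const_nhds (x := (2:ℝ))).sub this
    rw [Real.exp_zero] at h
    rw [show (2 : ℝ) - 1 = 1 by norm_num] at h
    exact h
  exact tendsto_of_tendsto_of_tendsto_of_le_of_le hlim2 tendsto_const_nhds
    (fun i => (hbd i).1) (fun i => (hbd i).2)

end
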